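/- Let α > 0 and let A and B be bounded self-adjoint operators on a separable Hilbert space such that rank(A − B) < ∞. Then for every function f in the Hölder–Zygmund class Λ_α(ℝ), the operator f(A) − f(B) belongs to the weak Schatten class S_{1/α,∞}. -/

import Mathlib

open scoped BigOperators
noncomputable section

/-- The `j`-th singular value of a bounded operator `T` on a Hilbert space:
`s_j(T) = inf {‖T - R‖ : rank R ≤ j}`. -/
def sVal {H : Type} [NormedAddCommGroup H] [InnerProductSpace ℂ H] [CompleteSpace H]
    (T : H →L[ℂ] H) (j : ℕ) : ℝ :=
  sInf {c : ℝ | ∃ R : H →L[ℂ] H, LinearMap.rank (R : H →ₗ[ℂ] H) ≤ (j : Cardinal) ∧ c = ‖T - R‖}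

/-- Membership in the weak Schatten class `S_{p,∞}`:  `sup_j (1+j) s_j(T)^p < ∞`. -/
def MemWeakSchatten {H : Type} [NormedAddCommGroup H] [InnerProductSpace ℂ H] [CompleteSpace H]
    (p : ℝ) (T : H →L[ℂ] H) : Prop :=
  ∃ C : ℝ, ∀ j : ℕ, (1 + (j : ℝ)) * sVal T j ^ p ≤ C

/-- The weak Schatten quasinorm `‖T‖_{S_{p,∞}} = (sup_{j ≥ 0} (1+j) s_j(T)^p)^{1/p}`. -/
def wkNorm {H : Type} [NormedAddCommGroup H] [InnerProductSpace ℂ H] [CompleteSpace H]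
    (p : ℝ) (T : H →L[ℂ] H) : ℝ :=
  (⨆ j : ℕ, (1 + (j : ℝ)) * sVal T j ^ p) ^ (1 / p)

/-- `f(A)` for a bounded self-adjoint operator `A` (whose spectrum is real), via the continuous
functional calculus. -/
def opFun {H : Type} [NormedAddCommGroup H] [InnerProductSpace ℂ H] [CompleteSpace H]
    (f : ℝ → ℂ) (A : H →L[ℂ] H) : H →L[ℂ] H :=
  cfc (fun z : ℂ => f z.re) A

/-- The difference operator `(Δ_t f)(x) = f(x + t) - f(x)`. -/
def fdiff (t : ℝ) (f : ℝ → ℂ) : ℝ → ℂ := fun x => f (x + t) - f x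

/-- `f` satisfies the Hölder–Zygmund condition of order `α` (via `m`-th differences) with
constant `C`: `|(Δ_t^m f)(x)| ≤ C |t|^α`. -/
def HZWith (m : ℕ) (C α : ℝ) (f : ℝ → ℂ) : Prop :=
  ∀ x t : ℝ, ‖(fdiff t)^[m] f x‖ ≤ C * |t| ^ α

/-- The Hölder–Zygmund norm `‖f‖_{Λ_α(ℝ)} = sup_{x, t ≠ 0} |(Δ_t^m f)(x)|/|t|^α`, where `m` is the
least integer greater than `α`, realized as the least admissible constant. -/
def hzNorm (α : ℝ) (f : ℝ → ℂ) : ℝ :=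
  sInf {C : ℝ | 0 ≤ C ∧ HZWith (Nat.floor α + 1) C α f}

/-- Membership in the Hölder–Zygmund class `Λ_α(ℝ)`: bounded continuous functions satisfying the
Hölder–Zygmund condition of order `α` via `m`-th differences, `m` the least integer `> α`. -/
def MemHZ (α : ℝ) (f : ℝ → ℂ) : Prop :=
  Continuous f ∧ (∃ M : ℝ, ∀ x, ‖f x‖ ≤ M) ∧
    ∃ C : ℝ, 0 ≤ C ∧ HZWith (Nat.floor α + 1) C α f

open MeasureTheory

lemma integrable_abs_rpow_mul_inv_one_add_pow {a : ℝ} (ha : 0 ≤ a) {n : ℕ} (hn : a + 1 < n) :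
    Integrable fun x : ℝ => |x| ^ a * ((1 + |x|) ^ n)⁻¹ := by
  have h : Integrable (fun x : ℝ => (1 + ‖x‖) ^ (-((n : ℝ) - a))) :=
    integrable_one_add_norm (by simp; linarith)
  refine h.mono' ?_ (Filter.Eventually.of_forall fun x => ?_)
  · refine Continuous.aestronglyMeasurable ?_
    refine (continuous_abs.rpow_const fun _ => Or.inr ha).mul (Continuous.inv₀ (by fun_prop) ?_)
    intro x
    positivity
  · have hx : 0 < 1 + |x| := by positivity
    rw [Real.norm_of_nonneg (by positivity), Real.norm_eq_abs, neg_sub, Real.rpow_sub hx,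
      Real.rpow_natCast, div_eq_mul_inv]
    gcongr
    linarith

lemma integrable_inv_one_add_abs_pow {n : ℕ} (hn : 2 ≤ n) :
    Integrable fun x : ℝ => ((1 + |x|) ^ n)⁻¹ := by
  have h2 : (2 : ℝ) ≤ n := by exact_mod_cast hn
  simpa using integrable_abs_rpow_mul_inv_one_add_pow (le_refl (0 : ℝ)) (n := n) (by linarith)

lemma differentiable_dslope_sin : Differentiable ℂ (dslope Complex.sin 0) := by
  rw [← differentiableOn_univ]
  exact (Complex.differentiableOn_dslope Filter.univ_mem).2
    Complex.differentiable_sin.differentiableOn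

lemma norm_sin_le_exp_abs_im (z : ℂ) : ‖Complex.sin z‖ ≤ Real.exp |z.im| := by
  rw [Complex.sin]
  have h1 : ‖Complex.exp (-z * Complex.I)‖ ≤ Real.exp |z.im| := by
    rw [Complex.norm_exp]
    simpa using le_abs_self z.im
  have h2 : ‖Complex.exp (z * Complex.I)‖ ≤ Real.exp |z.im| := by
    rw [Complex.norm_exp]
    simpa using neg_le_abs z.im
  rw [norm_div, norm_mul, Complex.norm_I]
  have := norm_sub_le (Complex.exp (-z * Complex.I)) (Complex.exp (z * Complex.I))
  norm_num
  simp only [neg_mul] at *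
  linarith

lemma exists_norm_dslope_sin_le :
    ∃ C : ℝ, 0 ≤ C ∧ ∀ z : ℂ, ‖dslope Complex.sin 0 z‖ ≤ C * Real.exp |z.im| * (1 + ‖z‖)⁻¹ := by
  obtain ⟨b, hb⟩ := (isCompact_closedBall (0 : ℂ) 1).exists_bound_of_continuousOn
    differentiable_dslope_sin.continuous.continuousOn
  refine ⟨2 * max b 1, by positivity, fun z => ?_⟩
  rw [le_mul_inv_iff₀ (by positivity)]
  have hexp : 1 ≤ Real.exp |z.im| := Real.one_le_exp (abs_nonneg _)
  have hb1 : 1 ≤ max b 1 := le_max_right _ _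
  rcases le_total ‖z‖ 1 with hz | hz
  · calc ‖dslope Complex.sin 0 z‖ * (1 + ‖z‖) ≤ max b 1 * 2 := by
          gcongr
          · exact (hb z (by simpa using hz)).trans (le_max_left _ _)
          · linarith
      _ ≤ 2 * max b 1 * Real.exp |z.im| := by nlinarith
  · have hz0 : z ≠ 0 := by
      rintro rfl
      norm_num at hz
    rw [dslope_of_ne _ hz0, slope_def_field]
    simp only [Complex.sin_zero, sub_zero, norm_div]
    calc ‖Complex.sin z‖ / ‖z‖ * (1 + ‖z‖) ≤ Real.exp |z.im| / ‖z‖ * (2 * ‖z‖) := by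
          gcongr
          · exact norm_sin_le_exp_abs_im z
          · linarith
      _ = 2 * 1 * Real.exp |z.im| := by field_simp
      _ ≤ 2 * max b 1 * Real.exp |z.im| := by gcongr

/-- An entire kernel of exponential type with unit mass and prescribed polynomial decay. -/
lemma exists_entire_kernel {q : ℕ} (hq : 1 ≤ q) :
    ∃ K : ℂ → ℂ, Differentiable ℂ K ∧
      (∃ C c : ℝ, 0 ≤ C ∧ 0 < c ∧ ∀ (x : ℝ) (w : ℂ),
        ‖K (x - w)‖ ≤ C * Real.exp (c * ‖w‖) * ((1 + |x|) ^ (2 * q))⁻¹) ∧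
      ∫ x : ℝ, K x = 1 := by
  obtain ⟨C, hC, hb⟩ := exists_norm_dslope_sin_le
  set S : ℂ → ℂ := dslope Complex.sin 0 with hS
  have hSd : Differentiable ℂ S := differentiable_dslope_sin
  have hbound : ∀ (x : ℝ) (w : ℂ), ‖S (x - w) ^ (2 * q)‖ ≤
      C ^ (2 * q) * Real.exp ((2 * (2 * q : ℕ)) * ‖w‖) * ((1 + |x|) ^ (2 * q))⁻¹ := by
    intro x w
    have h1 : ‖S (x - w)‖ ≤ C * Real.exp (2 * ‖w‖) * (1 + |x|)⁻¹ := by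
      refine (hb _).trans ?_
      have him : |((x : ℂ) - w).im| ≤ ‖w‖ := by simpa using Complex.abs_im_le_norm w
      have hx : |x| ≤ ‖(x : ℂ) - w‖ + ‖w‖ := by
        simpa using norm_add_le ((x : ℂ) - w) w
      have he : 1 + ‖w‖ ≤ Real.exp ‖w‖ := by linarith [Real.add_one_le_exp ‖w‖]
      have h0 := norm_nonneg w
      have h0' := norm_nonneg ((x : ℂ) - w)
      rw [two_mul, Real.exp_add, ← mul_assoc, mul_assoc (C * Real.exp ‖w‖)]
      refine mul_le_mul (by gcongr) ?_ (by positivity) (by positivity)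
      rw [← div_eq_mul_inv, inv_eq_one_div, div_le_div_iff₀ (by positivity) (by positivity)]
      nlinarith
    rw [norm_pow]
    calc ‖S (x - w)‖ ^ (2 * q) ≤ (C * Real.exp (2 * ‖w‖) * (1 + |x|)⁻¹) ^ (2 * q) := by gcongr
      _ = _ := by
        rw [mul_pow, mul_pow, ← Real.exp_nat_mul, inv_pow]
        congr 3
        ring
  have hreal : ∀ x : ℝ, S x = ((S x).re : ℂ) := by
    intro x
    by_cases hx : (x : ℂ) = 0
    · rw [hx, hS, dslope_same]
      simp
    · rw [hS, dslope_of_ne _ hx, slope_def_field, Complex.sin_zero, sub_zero, sub_zero,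
        ← Complex.ofReal_sin, ← Complex.ofReal_div, Complex.ofReal_re]
  have hcont : Continuous fun x : ℝ => (S x).re ^ (2 * q) :=
    (Complex.continuous_re.comp (hSd.continuous.comp Complex.continuous_ofReal)).pow _
  have hint : Integrable fun x : ℝ => (S x).re ^ (2 * q) := by
    refine ((integrable_inv_one_add_abs_pow (n := 2 * q) (by omega)).const_mul
      (C ^ (2 * q))).mono' hcont.aestronglyMeasurable (Filter.Eventually.of_forall fun x => ?_)
    have h := hbound x 0
    rw [sub_zero, hreal, norm_zero, mul_zero, Real.exp_zero, mul_one, ← Complex.ofReal_pow,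
      Complex.norm_real] at h
    exact h
  have hpos : 0 < ∫ x : ℝ, (S x).re ^ (2 * q) := by
    refine integral_pos_of_integrable_nonneg_nonzero (x := 0) hcont hint
      (fun x => (even_two_mul q).pow_nonneg _) ?_
    simp [hS, dslope_same]
  set I : ℝ := ∫ x : ℝ, (S x).re ^ (2 * q) with hI
  refine ⟨fun z => (I : ℂ)⁻¹ * S z ^ (2 * q), (hSd.pow _).const_mul _,
    ⟨I⁻¹ * C ^ (2 * q), 2 * (2 * q : ℕ), by positivity, by positivity, fun x w => ?_⟩, ?_⟩
  · rw [norm_mul, norm_inv, Complex.norm_real, Real.norm_of_nonneg hpos.le, mul_assoc, mul_assoc]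
    have := hbound x w
    rw [mul_assoc] at this
    gcongr
  · rw [integral_const_mul]
    have : (∫ x : ℝ, S x ^ (2 * q)) = (I : ℂ) := by
      rw [hI, ← integral_complex_ofReal]
      congr 1 with x
      rw [hreal]
      simp
    rw [this, inv_mul_cancel₀ (by exact_mod_cast hpos.ne')]

lemma norm_taylor_sub_le {K : ℂ → ℂ} (hK : Differentiable ℂ K) {n : ℕ} {C c : ℝ}
    (hC : 0 ≤ C) (hb : ∀ (x : ℝ) (w : ℂ),
      ‖K (x - w)‖ ≤ C * Real.exp (c * ‖w‖) * ((1 + |x|) ^ n)⁻¹)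
    {R : ℝ} (hR : 0 < R) (N : ℕ) (u h : ℝ) (hh : |h| ≤ R / 2) :
    ‖∑ j ∈ Finset.range N, (j.factorial : ℂ)⁻¹ • (-(h : ℂ)) ^ j • iteratedDeriv j K u
        - K (u - h)‖ ≤ 2 * C * Real.exp (c * R) * (1 / 2) ^ N * ((1 + |u|) ^ n)⁻¹ := by
  set E : ℝ := C * Real.exp (c * R) * ((1 + |u|) ^ n)⁻¹ with hE
  have hE0 : 0 ≤ E := by positivity
  have hcoef (j : ℕ) : ‖iteratedDeriv j K u‖ ≤ j.factorial * E / R ^ j := by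
    refine Complex.norm_iteratedDeriv_le_of_forall_mem_sphere_norm_le j hR hK.diffContOnCl ?_
    intro z hz
    have hz' : ‖(u : ℂ) - z‖ = R := by
      rw [← mem_sphere_iff_norm.1 hz, norm_sub_rev]
    have := hb u (u - z)
    rwa [sub_sub_cancel, hz'] at this
  have hsum := Complex.hasSum_taylorSeries_of_entire hK (u : ℂ) ((u : ℂ) - h)
  rw [sub_sub_cancel_left] at hsum
  have hterm (j : ℕ) : ‖(j.factorial : ℂ)⁻¹ • (-(h : ℂ)) ^ j • iteratedDeriv j K u‖
      ≤ E * (1 / 2) ^ j := by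
    have hj : (0 : ℝ) < j.factorial := by exact_mod_cast j.factorial_pos
    rw [norm_smul, norm_smul, norm_pow, norm_neg, norm_inv, Complex.norm_real, Real.norm_eq_abs,
      Complex.norm_natCast]
    calc (j.factorial : ℝ)⁻¹ * (|h| ^ j * ‖iteratedDeriv j K u‖)
        ≤ (j.factorial : ℝ)⁻¹ * ((R / 2) ^ j * (j.factorial * E / R ^ j)) := by
          gcongr
          exact hcoef j
      _ = E * (1 / 2) ^ j := by
          rw [div_pow, div_pow, one_pow]
          field_simp
  refine (norm_sub_le_of_geometric_bound_of_hasSum (by norm_num) hterm hsum N).trans_eq ?_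
  rw [hE]
  ring

open Polynomial in
/-- Convolutions with an entire kernel of exponential type are close to polynomials. -/
lemma exists_polynomial_near_convolution {K : ℂ → ℂ} (hK : Differentiable ℂ K) {n : ℕ}
    (hn : 2 ≤ n) {C c : ℝ} (hC : 0 ≤ C) (hb : ∀ (x : ℝ) (w : ℂ),
      ‖K (x - w)‖ ≤ C * Real.exp (c * ‖w‖) * ((1 + |x|) ^ n)⁻¹)
    {g : ℝ → ℂ} (hg : Continuous g) {M : ℝ} (hM : ∀ x, ‖g x‖ ≤ M)
    {R : ℝ} (hR : 0 < R) (N : ℕ) :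
    ∃ P : ℂ[X], P.natDegree ≤ N ∧ ∀ h : ℝ, |h| ≤ R / 2 →
      ‖(∫ u : ℝ, g u * K (u - h)) - P.eval (h : ℂ)‖ ≤
        M * (2 * C * Real.exp (c * R) * (1 / 2) ^ (N + 1)) * ∫ u : ℝ, ((1 + |u|) ^ n)⁻¹ := by
  have hM0 : 0 ≤ M := (norm_nonneg _).trans (hM 0)
  have hw := integrable_inv_one_add_abs_pow hn
  have hderivCont (j : ℕ) : Continuous fun u : ℝ => iteratedDeriv j K u :=
    ((hK.contDiff (n := j)).continuous_iteratedDeriv j le_rfl).comp Complex.continuous_ofReal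
  have hderivInt (j : ℕ) : Integrable fun u : ℝ => g u * iteratedDeriv j K u := by
    refine (hw.const_mul (M * (j.factorial * (C * Real.exp c)))).mono'
      (hg.mul (hderivCont j)).aestronglyMeasurable (Filter.Eventually.of_forall fun u => ?_)
    rw [norm_mul, mul_assoc]
    refine mul_le_mul (hM u) ?_ (norm_nonneg _) hM0
    have := Complex.norm_iteratedDeriv_le_of_forall_mem_sphere_norm_le (c := (u : ℂ)) (R := 1)
      (C := C * Real.exp c * ((1 + |u|) ^ n)⁻¹) j one_pos hK.diffContOnCl ?_
    · simpa [mul_assoc] using this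
    · intro z hz
      have hz' : ‖(u : ℂ) - z‖ = 1 := by
        rw [← mem_sphere_iff_norm.1 hz, norm_sub_rev]
      have := hb u (u - z)
      rwa [sub_sub_cancel, hz', mul_one] at this
  refine ⟨∑ j ∈ Finset.range (N + 1), Polynomial.C ((j.factorial : ℂ)⁻¹ * (-1) ^ j *
    ∫ u : ℝ, g u * iteratedDeriv j K u) * X ^ j, ?_, fun h hh => ?_⟩
  · refine natDegree_sum_le_of_forall_le _ _ fun j hj => (natDegree_C_mul_X_pow_le _ _).trans ?_
    have := Finset.mem_range.1 hj
    omega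
  · have hconv : Integrable fun u : ℝ => g u * K (u - h) := by
      refine (hw.const_mul (M * (C * Real.exp (c * ‖(h : ℂ)‖)))).mono'
        (hg.mul (hK.continuous.comp
          (Complex.continuous_ofReal.sub continuous_const))).aestronglyMeasurable
        (Filter.Eventually.of_forall fun u => ?_)
      rw [norm_mul, mul_assoc]
      exact mul_le_mul (hM u) (hb u h) (norm_nonneg _) hM0
    have heval : (∑ j ∈ Finset.range (N + 1), Polynomial.C ((j.factorial : ℂ)⁻¹ * (-1) ^ j *
          ∫ u : ℝ, g u * iteratedDeriv j K u) * X ^ j).eval (h : ℂ)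
        = ∫ u : ℝ, ∑ j ∈ Finset.range (N + 1),
          ((j.factorial : ℂ)⁻¹ * (-(h : ℂ)) ^ j) * (g u * iteratedDeriv j K u) := by
      rw [integral_finsetSum _ fun j _ => (hderivInt j).const_mul _, eval_finsetSum]
      refine Finset.sum_congr rfl fun j _ => ?_
      rw [integral_const_mul, eval_mul, eval_C, eval_pow, eval_X, neg_pow (h : ℂ)]
      ring
    rw [heval, ← integral_sub hconv
      (integrable_finsetSum _ fun j _ => (hderivInt j).const_mul _), ← integral_const_mul]
    refine norm_integral_le_of_norm_le (hw.const_mul _) (Filter.Eventually.of_forall fun u => ?_)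
    have hrw : g u * K (u - h) - ∑ j ∈ Finset.range (N + 1),
          ((j.factorial : ℂ)⁻¹ * (-(h : ℂ)) ^ j) * (g u * iteratedDeriv j K u)
        = -(g u * (∑ j ∈ Finset.range (N + 1),
          (j.factorial : ℂ)⁻¹ • (-(h : ℂ)) ^ j • iteratedDeriv j K u - K (u - h))) := by
      rw [mul_sub, neg_sub, Finset.mul_sum]
      congr 1
      refine Finset.sum_congr rfl fun j _ => ?_
      simp only [smul_eq_mul]
      ring
    rw [hrw, norm_neg, norm_mul, mul_assoc]
    exact mul_le_mul (hM u) (norm_taylor_sub_le hK hC hb hR (N + 1) u h hh) (norm_nonneg _) hM0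

open Polynomial in
lemma exists_polynomial_near_mollification {K : ℂ → ℂ} (hK : Differentiable ℂ K) {n : ℕ}
    (hn : 2 ≤ n) {C c : ℝ} (hC : 0 ≤ C) (hb : ∀ (x : ℝ) (w : ℂ),
      ‖K (x - w)‖ ≤ C * Real.exp (c * ‖w‖) * ((1 + |x|) ^ n)⁻¹)
    {f : ℝ → ℂ} (hf : Continuous f) {M : ℝ} (hM : ∀ x, ‖f x‖ ≤ M)
    {σ L k : ℝ} (hσ : 0 < σ) (hL : 0 < L) (hk : 1 ≤ k) (N : ℕ) :
    ∃ P : ℂ[X], P.natDegree ≤ N ∧ ∀ x : ℝ, |x| ≤ L →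
      ‖(∫ t : ℝ, f (x + k * (t / σ)) * K t) - P.eval (x : ℂ)‖ ≤
        M * (2 * C * Real.exp (c * (2 * σ * L)) * (1 / 2) ^ (N + 1)) *
          ∫ u : ℝ, ((1 + |u|) ^ n)⁻¹ := by
  have hk0 : 0 < k := by linarith
  obtain ⟨P, hP, hPb⟩ := exists_polynomial_near_convolution hK hn hC hb
    (g := fun u => f (k * (u / σ))) (by fun_prop) (fun x => hM _) (R := 2 * σ * L)
    (by positivity) N
  refine ⟨P.comp (Polynomial.C ((σ / k : ℝ) : ℂ) * X), ?_, fun x hx => ?_⟩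
  · have hX : (Polynomial.C ((σ / k : ℝ) : ℂ) * X).natDegree ≤ 1 := by
      simpa using natDegree_C_mul_X_pow_le ((σ / k : ℝ) : ℂ) 1
    exact natDegree_comp_le.trans ((Nat.mul_le_mul hP hX).trans_eq (mul_one N))
  · have h := hPb (σ / k * x) (by
      rw [abs_mul, abs_of_pos (by positivity)]
      calc σ / k * |x| ≤ σ / 1 * L := by gcongr
        _ = 2 * σ * L / 2 := by ring)
    have hshift : (∫ t : ℝ, f (x + k * (t / σ)) * K t)
        = ∫ u : ℝ, f (k * (u / σ)) * K (u - (σ / k * x : ℝ)) := by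
      rw [← integral_sub_right_eq_self (fun t : ℝ => f (x + k * (t / σ)) * K t) (σ / k * x)]
      congr 1 with u
      rw [Complex.ofReal_sub]
      congr 2
      field_simp
      ring
    rw [hshift, eval_comp]
    simpa using h

lemma fdiff_iterate_eq (m : ℕ) (f : ℝ → ℂ) (x t : ℝ) :
    (fdiff t)^[m] f x = (-1) ^ m * f x + ∑ k ∈ Finset.range m,
      ((-1) ^ (m - (k + 1)) * (m.choose (k + 1) : ℂ)) * f (x + (k + 1 : ℕ) * t) := by
  have h := fwdDiff_iter_eq_sum_shift t f m x
  rw [Finset.sum_range_succ'] at h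
  change (fwdDiff t)^[m] f x = _
  rw [h, add_comm]
  simp

lemma exists_three_fourths_pow_le (α : ℝ) :
    ∃ D : ℝ, 0 ≤ D ∧ ∀ N : ℕ, (3 / 4 : ℝ) ^ (N + 1) ≤ D * ((N : ℝ) + 1) ^ (-α) := by
  obtain ⟨D, hD⟩ := (tendsto_pow_const_mul_const_pow_of_lt_one ⌈α⌉₊
    (by norm_num : (0 : ℝ) ≤ 3 / 4) (by norm_num)).bddAbove_range
  have hD' (n : ℕ) : (n : ℝ) ^ ⌈α⌉₊ * (3 / 4 : ℝ) ^ n ≤ D := hD ⟨n, rfl⟩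
  refine ⟨D, le_trans (by positivity) (hD' 0), fun N => ?_⟩
  have hN : (0 : ℝ) < (N : ℝ) + 1 := by positivity
  rw [Real.rpow_neg hN.le, le_mul_inv_iff₀ (by positivity), mul_comm]
  refine le_trans ?_ (hD' (N + 1))
  push_cast
  gcongr
  rw [← Real.rpow_natCast]
  exact Real.rpow_le_rpow_of_exponent_le (by linarith [N.cast_nonneg (α := ℝ)]) (Nat.le_ceil α)

open Polynomial in
/-- Jackson's inequality for the Hölder–Zygmund classes on a bounded interval. -/
lemma MemHZ.exists_polynomial_near {α : ℝ} (hα : 0 < α) {f : ℝ → ℂ} (hf : MemHZ α f)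
    {L : ℝ} (hL : 0 < L) :
    ∃ D : ℝ, 0 ≤ D ∧ ∀ N : ℕ, ∃ P : ℂ[X], P.natDegree ≤ N ∧ ∀ x : ℝ, |x| ≤ L →
      ‖f x - P.eval (x : ℂ)‖ ≤ D * ((N : ℝ) + 1) ^ (-α) := by
  obtain ⟨hfc, ⟨M, hM⟩, Z, hZ0, hZ⟩ := hf
  have hM0 : 0 ≤ M := (norm_nonneg _).trans (hM 0)
  set m := ⌊α⌋₊ + 1 with hm
  set q := ⌈α⌉₊ + 1 with hq
  have hq2 : α + 1 < (2 * q : ℕ) := by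
    have := Nat.le_ceil α
    rw [hq]
    push_cast
    linarith
  have hn : 2 ≤ 2 * q := by omega
  obtain ⟨K, hKd, ⟨C, c, hC, hc, hb⟩, hK1⟩ := exists_entire_kernel (q := q) (by omega)
  obtain ⟨D, hD0, hD⟩ := exists_three_fourths_pow_le α
  set W := ∫ u : ℝ, ((1 + |u|) ^ (2 * q))⁻¹ with hW
  have hW0 : 0 ≤ W := integral_nonneg fun u => by positivity
  set V := ∫ u : ℝ, |u| ^ α * ((1 + |u|) ^ (2 * q))⁻¹ with hV
  have hV0 : 0 ≤ V := integral_nonneg fun u => by positivity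
  have hw := integrable_inv_one_add_abs_pow hn
  have hv := integrable_abs_rpow_mul_inv_one_add_pow hα.le hq2
  have hKb (t : ℝ) : ‖K t‖ ≤ C * ((1 + |t|) ^ (2 * q))⁻¹ := by simpa using hb t 0
  set δ : ℝ := (8 * c * L)⁻¹ with hδ
  have hδ0 : 0 < δ := by positivity
  set b : ℕ → ℂ := fun k => (-1) ^ (m - (k + 1)) * (m.choose (k + 1) : ℂ) with hbdef
  refine ⟨Z * C * δ ^ (-α) * V + (∑ k ∈ Finset.range m, ‖b k‖) * (M * (2 * C) * W) * D,
    by positivity, fun N => ?_⟩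
  set σ : ℝ := δ * ((N : ℝ) + 1) with hσ
  have hσ0 : 0 < σ := by positivity
  choose P hPdeg hP using fun k : ℕ => exists_polynomial_near_mollification hKd hn hC hb hfc hM
    hσ0 hL (k := (k + 1 : ℕ)) (by simp) N
  refine ⟨∑ k ∈ Finset.range m, Polynomial.C (-(-1) ^ m * b k) * P k, ?_, fun x hx => ?_⟩
  · exact natDegree_sum_le_of_forall_le _ _ fun k _ =>
      (natDegree_C_mul_le _ _).trans (hPdeg k)
  have hint (k : ℝ) : Integrable fun t : ℝ => f (x + k * (t / σ)) * K t := by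
    refine (hw.const_mul (M * C)).mono' ?_ (Filter.Eventually.of_forall fun t => ?_)
    · exact (Continuous.mul (by fun_prop)
        (hKd.continuous.comp Complex.continuous_ofReal)).aestronglyMeasurable
    · rw [norm_mul, mul_assoc]
      exact mul_le_mul (hM _) (hKb t) (norm_nonneg _) hM0
  set G : ℕ → ℂ := fun k => ∫ t : ℝ, f (x + (k + 1 : ℕ) * (t / σ)) * K t with hG
  have hexp : Real.exp (c * (2 * σ * L)) * (1 / 2) ^ (N + 1) ≤ D * ((N : ℝ) + 1) ^ (-α) := by
    refine le_trans ?_ (hD N)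
    have h1 : c * (2 * σ * L) = ((N + 1 : ℕ) : ℝ) * (1 / 4) := by
      rw [hσ, hδ]
      push_cast
      field_simp
      norm_num
    rw [h1, Real.exp_nat_mul, ← mul_pow]
    gcongr
    have h2 : Real.exp (1 / 4) ≤ 3 / 2 := by
      have h := Real.add_one_le_exp (-(1 / 4) : ℝ)
      rw [Real.exp_neg] at h
      have h3 : (3 / 4 : ℝ) ≤ (Real.exp (1 / 4))⁻¹ := by linarith
      rw [le_inv_comm₀ (by norm_num) (Real.exp_pos _)] at h3
      exact h3.trans (by norm_num)
    linarith
  have hsmooth : ‖f x + (-1) ^ m * ∑ k ∈ Finset.range m, b k * G k‖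
      ≤ Z * C * δ ^ (-α) * V * ((N : ℝ) + 1) ^ (-α) := by
    have hfx : f x = ∫ t : ℝ, f (x + 0 * (t / σ)) * K t := by
      simp [integral_const_mul, hK1]
    have hsum : f x + (-1) ^ m * ∑ k ∈ Finset.range m, b k * G k
        = ∫ t : ℝ, (-1) ^ m * ((fdiff (t / σ))^[m] f x) * K t := by
      rw [hfx]
      simp only [hG, ← integral_const_mul]
      rw [← integral_finsetSum _ fun k _ => (hint _).const_mul _, ← integral_const_mul,
        ← integral_add (hint 0)
          ((integrable_finsetSum _ fun k _ => (hint _).const_mul _).const_mul _)]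
      congr 1 with t
      have hsq : ((-1 : ℂ) ^ m) * (-1) ^ m = 1 := by
        rw [← mul_pow]
        simp
      rw [fdiff_iterate_eq, mul_add, ← mul_assoc ((-1 : ℂ) ^ m), hsq, add_mul, one_mul,
        mul_assoc, Finset.sum_mul]
      simp [hbdef, mul_assoc]
    have hscale : Z * C * δ ^ (-α) * V * ((N : ℝ) + 1) ^ (-α)
        = ∫ t : ℝ, (Z * C * σ ^ (-α)) * (|t| ^ α * ((1 + |t|) ^ (2 * q))⁻¹) := by
      rw [integral_const_mul, ← hV, hσ, Real.mul_rpow hδ0.le (by positivity)]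
      ring
    rw [hsum, hscale]
    refine norm_integral_le_of_norm_le (hv.const_mul _) (Filter.Eventually.of_forall fun t => ?_)
    have hdiff := hZ x (t / σ)
    rw [abs_div, abs_of_pos hσ0, Real.div_rpow (abs_nonneg _) hσ0.le,
      div_eq_mul_inv (|t| ^ α), ← Real.rpow_neg hσ0.le] at hdiff
    rw [norm_mul, norm_mul, norm_pow, norm_neg, norm_one, one_pow, one_mul]
    calc ‖(fdiff (t / σ))^[m] f x‖ * ‖K t‖
        ≤ (Z * (|t| ^ α * σ ^ (-α))) * (C * ((1 + |t|) ^ (2 * q))⁻¹) :=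
          mul_le_mul hdiff (hKb t) (norm_nonneg _) (by positivity)
      _ = _ := by ring
  have hpoly : ‖(-1) ^ m * ∑ k ∈ Finset.range m, b k * (G k - (P k).eval (x : ℂ))‖
      ≤ (∑ k ∈ Finset.range m, ‖b k‖) * (M * (2 * C) * W) * D * ((N : ℝ) + 1) ^ (-α) := by
    rw [norm_mul, norm_pow, norm_neg, norm_one, one_pow, one_mul, Finset.sum_mul, Finset.sum_mul,
      Finset.sum_mul]
    refine norm_sum_le_of_le _ fun k _ => ?_
    rw [norm_mul, mul_assoc, mul_assoc]
    refine mul_le_mul_of_nonneg_left ((hP k x hx).trans ?_) (norm_nonneg _)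
    calc M * (2 * C * Real.exp (c * (2 * σ * L)) * (1 / 2) ^ (N + 1)) * W
        = M * (2 * C) * W * (Real.exp (c * (2 * σ * L)) * (1 / 2) ^ (N + 1)) := by ring
      _ ≤ M * (2 * C) * W * (D * ((N : ℝ) + 1) ^ (-α)) := by gcongr
  have hsplit : f x - (∑ k ∈ Finset.range m, Polynomial.C (-(-1) ^ m * b k) * P k).eval (x : ℂ)
      = (f x + (-1) ^ m * ∑ k ∈ Finset.range m, b k * G k)
        - (-1) ^ m * ∑ k ∈ Finset.range m, b k * (G k - (P k).eval (x : ℂ)) := by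
    simp only [eval_finsetSum, eval_mul, eval_C, mul_sub, Finset.sum_sub_distrib]
    simp only [neg_mul, Finset.sum_neg_distrib, mul_assoc, ← Finset.mul_sum]
    ring
  rw [hsplit, add_mul]
  exact (norm_sub_le _ _).trans (add_le_add hsmooth hpoly)

/-- The span of the vectors `A ^ i (A - B) v`, `i < N`. -/
def perturbationSpan {H : Type*} [NormedAddCommGroup H] [InnerProductSpace ℂ H]
    (A B : H →L[ℂ] H) : ℕ → Submodule ℂ H
  | 0 => ⊥
  | N + 1 => (perturbationSpan A B N).map (A : H →ₗ[ℂ] H) ⊔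
      LinearMap.range ((A - B : H →L[ℂ] H) : H →ₗ[ℂ] H)

section perturbationSpan

variable {H : Type*} [NormedAddCommGroup H] [InnerProductSpace ℂ H] (A B : H →L[ℂ] H)

lemma perturbationSpan_mono : Monotone (perturbationSpan A B) := by
  refine monotone_nat_of_le_succ fun N => ?_
  induction N with
  | zero => exact bot_le
  | succ N ih => exact sup_le_sup_right (Submodule.map_mono ih) _

lemma pow_sub_pow_apply_mem_perturbationSpan (N : ℕ) (v : H) :
    (A ^ N - B ^ N) v ∈ perturbationSpan A B N := by
  induction N with
  | zero => simp
  | succ N ih =>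
    have h : (A ^ (N + 1) - B ^ (N + 1)) v = A ((A ^ N - B ^ N) v) + (A - B) ((B ^ N) v) := by
      simp [pow_succ']
    rw [h]
    exact Submodule.add_mem_sup (Submodule.mem_map_of_mem ih) ⟨_, rfl⟩

open Polynomial in
lemma aeval_sub_aeval_apply_mem_perturbationSpan {N : ℕ} {P : ℂ[X]} (hP : P.natDegree ≤ N)
    (v : H) : (aeval A P - aeval B P) v ∈ perturbationSpan A B N := by
  rw [aeval_eq_sum_range, aeval_eq_sum_range, ← Finset.sum_sub_distrib,
    _root_.sum_apply]
  refine Submodule.sum_mem _ fun i hi => ?_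
  rw [← smul_sub]
  refine Submodule.smul_mem _ _ (perturbationSpan_mono A B ?_
    (pow_sub_pow_apply_mem_perturbationSpan A B i v))
  have := Finset.mem_range.1 hi
  omega

lemma rank_perturbationSpan_le (N : ℕ) :
    Module.rank ℂ (perturbationSpan A B N) ≤
      N * LinearMap.rank ((A - B : H →L[ℂ] H) : H →ₗ[ℂ] H) := by
  induction N with
  | zero =>
    rw [perturbationSpan, rank_bot]
    exact zero_le
  | succ N ih =>
    refine (Submodule.rank_add_le_rank_add_rank _ _).trans ?_
    rw [Nat.cast_succ, add_mul, one_mul]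
    exact add_le_add ((rank_map_le _ _).trans ih) le_rfl

end perturbationSpan

lemma sVal_nonneg {H : Type} [NormedAddCommGroup H] [InnerProductSpace ℂ H] [CompleteSpace H]
    (T : H →L[ℂ] H) (j : ℕ) : 0 ≤ sVal T j := by
  refine Real.sInf_nonneg ?_
  rintro _ ⟨R, -, rfl⟩
  exact norm_nonneg _

lemma sVal_le {H : Type} [NormedAddCommGroup H] [InnerProductSpace ℂ H] [CompleteSpace H]
    {T R : H →L[ℂ] H} {j : ℕ} (hR : LinearMap.rank (R : H →ₗ[ℂ] H) ≤ (j : Cardinal)) :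
    sVal T j ≤ ‖T - R‖ := by
  refine csInf_le ⟨0, ?_⟩ ⟨R, hR, rfl⟩
  rintro _ ⟨R, -, rfl⟩
  exact norm_nonneg _

open Polynomial in
lemma norm_opFun_sub_aeval_le {H : Type} [NormedAddCommGroup H] [InnerProductSpace ℂ H]
    [CompleteSpace H] {A : H →L[ℂ] H} (hA : IsSelfAdjoint A) {f : ℝ → ℂ} (hf : Continuous f)
    {L : ℝ} (hL : ‖A‖ ≤ L) {P : ℂ[X]} {ε : ℝ} (hε : 0 ≤ ε)
    (h : ∀ x : ℝ, |x| ≤ L → ‖f x - P.eval (x : ℂ)‖ ≤ ε) : ‖opFun f A - aeval A P‖ ≤ ε := by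
  have hn : IsStarNormal A := hA.isStarNormal
  rw [opFun, ← cfc_polynomial P A, ← cfc_sub (fun z : ℂ => f z.re) P.eval A
    (hf.comp Complex.continuous_re).continuousOn P.continuous.continuousOn]
  refine norm_cfc_le hε fun z hz => ?_
  have hre : z = z.re := hA.mem_spectrum_eq_re hz
  have hzn : ‖z‖ ≤ L := by
    obtain _ | _ := subsingleton_or_nontrivial H
    · simp [Subsingleton.elim A 0, spectrum.of_subsingleton] at hz
    · exact (spectrum.norm_le_norm_of_mem hz).trans hL
  have := h z.re ((Complex.abs_re_le_norm z).trans hzn)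
  rwa [← hre] at this

theorem stmt17 (α : ℝ) (hα : 0 < α)
    (H : Type) [NormedAddCommGroup H] [InnerProductSpace ℂ H] [CompleteSpace H]
    [TopologicalSpace.SeparableSpace H]
    (A B : H →L[ℂ] H) (hA : IsSelfAdjoint A) (hB : IsSelfAdjoint B)
    (hrank : LinearMap.rank ((A - B : H →L[ℂ] H) : H →ₗ[ℂ] H) < Cardinal.aleph0) :
    ∀ f : ℝ → ℂ, MemHZ α f →
      MemWeakSchatten (1 / α) (opFun f A - opFun f B) := by
  intro f hf
  obtain ⟨r, hr⟩ := Cardinal.lt_aleph0.1 hrank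
  set L : ℝ := ‖A‖ + ‖B‖ + 1 with hL
  have hAL : ‖A‖ ≤ L := by linarith [norm_nonneg B]
  have hBL : ‖B‖ ≤ L := by linarith [norm_nonneg A]
  obtain ⟨D, hD0, hD⟩ := hf.exists_polynomial_near hα (L := L) (by positivity)
  refine ⟨((r : ℝ) + 1) * (2 * D) ^ (1 / α), fun j => ?_⟩
  set N := j / (r + 1) with hN
  have hNr : N * r ≤ j := (Nat.mul_le_mul_left _ (Nat.le_succ r)).trans (Nat.div_mul_le_self _ _)
  have hj : (1 + (j : ℝ)) ≤ ((r : ℝ) + 1) * ((N : ℝ) + 1) := by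
    have : j + 1 ≤ (r + 1) * (N + 1) := Nat.lt_mul_div_succ j (Nat.succ_pos r)
    have h' : ((j + 1 : ℕ) : ℝ) ≤ ((r + 1) * (N + 1) : ℕ) := by exact_mod_cast this
    push_cast at h'
    linarith
  have hN0 : (0 : ℝ) < (N : ℝ) + 1 := by positivity
  obtain ⟨P, hPdeg, hP⟩ := hD N
  have hRrank : LinearMap.rank
      ((Polynomial.aeval A P - Polynomial.aeval B P : H →L[ℂ] H) : H →ₗ[ℂ] H) ≤ (j : Cardinal) := by
    have hle : LinearMap.range
        ((Polynomial.aeval A P - Polynomial.aeval B P : H →L[ℂ] H) : H →ₗ[ℂ] H) ≤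
        perturbationSpan A B N := by
      rintro _ ⟨v, rfl⟩
      exact aeval_sub_aeval_apply_mem_perturbationSpan A B hPdeg v
    refine (Submodule.rank_mono hle).trans ((rank_perturbationSpan_le A B N).trans ?_)
    rw [hr]
    exact_mod_cast hNr
  have hs : sVal (opFun f A - opFun f B) j ≤ 2 * D * ((N : ℝ) + 1) ^ (-α) := by
    refine (sVal_le hRrank).trans ?_
    rw [sub_sub_sub_comm]
    refine (norm_sub_le _ _).trans ?_
    have hε : 0 ≤ D * ((N : ℝ) + 1) ^ (-α) := by positivity
    linarith [norm_opFun_sub_aeval_le hA hf.1 hAL hε hP, norm_opFun_sub_aeval_le hB hf.1 hBL hε hP]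
  have hspow : sVal (opFun f A - opFun f B) j ^ (1 / α) ≤
      (2 * D) ^ (1 / α) * ((N : ℝ) + 1)⁻¹ := by
    refine (Real.rpow_le_rpow (sVal_nonneg _ _) hs (by positivity)).trans_eq ?_
    rw [Real.mul_rpow (by positivity) (by positivity), ← Real.rpow_mul hN0.le]
    congr 1
    rw [neg_mul, mul_one_div_cancel hα.ne', Real.rpow_neg_one]
  calc (1 + (j : ℝ)) * sVal (opFun f A - opFun f B) j ^ (1 / α)
      ≤ (((r : ℝ) + 1) * ((N : ℝ) + 1)) * ((2 * D) ^ (1 / α) * ((N : ℝ) + 1)⁻¹) :=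
        mul_le_mul hj hspow (Real.rpow_nonneg (sVal_nonneg _ _) _) (by positivity)
    _ = ((r : ℝ) + 1) * (2 * D) ^ (1 / α) := by field_simp
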